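/- For every real λ > 0, the quotient G₂((√λ) • x) / G₂(x) tends to 1 as x → 0 with x ≠ 0 in EuclideanSpace ℝ (Fin 2); i.e., Tendsto (fun x => G₂ ((Real.sqrt λ) • x) / G₂ x) (𝓝[≠] 0) (𝓝 1). -/

import Mathlib

open MeasureTheory Real Topology Filter

/-- The Bessel potential `G_n` on `ℝⁿ`. -/
noncomputable def besselG (n : ℕ) (x : EuclideanSpace ℝ (Fin n)) : ℝ :=
  ∫ t in Set.Ioi (0 : ℝ), (4 * Real.pi * t) ^ (-(n : ℝ) / 2) *
    Real.exp (-(‖x‖ ^ 2) / (4 * t) - t)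

/-- The two-dimensional heat kernel at squared distance `s`, damped by `exp (-m * t)`. -/
noncomputable def dampedHeatKernel (s m t : ℝ) : ℝ :=
  (4 * π * t)⁻¹ * exp (-s / (4 * t) - m * t)

lemma besselG_two (x : EuclideanSpace ℝ (Fin 2)) :
    besselG 2 x = ∫ t in Set.Ioi (0 : ℝ), dampedHeatKernel (‖x‖ ^ 2) 1 t := by
  have h : -((2 : ℕ) : ℝ) / 2 = -1 := by norm_num
  simp only [besselG, dampedHeatKernel, h, rpow_neg_one, one_mul]

lemma integral_dampedHeatKernel_scale {l : ℝ} (hl : 0 < l) (s : ℝ) :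
    ∫ t in Set.Ioi (0 : ℝ), dampedHeatKernel (l * s) 1 t =
      ∫ t in Set.Ioi (0 : ℝ), dampedHeatKernel s l t := by
  have h := integral_comp_mul_left_Ioi (dampedHeatKernel (l * s) 1) 0 hl
  rw [mul_zero, smul_eq_mul] at h
  rw [eq_comm, inv_mul_eq_iff_eq_mul₀ hl.ne'] at h
  rw [h, ← integral_const_mul]
  refine setIntegral_congr_fun measurableSet_Ioi fun t ht => ?_
  have ht : 0 < t := ht
  have he : -(l * s) / (4 * (l * t)) - 1 * (l * t) = -s / (4 * t) - l * t := by
    field_simp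
  simp only [dampedHeatKernel, he]
  field_simp

lemma measurable_dampedHeatKernel (s m : ℝ) : Measurable (dampedHeatKernel s m) := by
  unfold dampedHeatKernel
  fun_prop

lemma dampedHeatKernel_nonneg (s m : ℝ) {t : ℝ} (ht : 0 < t) : 0 ≤ dampedHeatKernel s m t := by
  unfold dampedHeatKernel
  positivity

lemma integrableOn_dampedHeatKernel {s m : ℝ} (hs : 0 < s) (hm : 0 < m) :
    IntegrableOn (dampedHeatKernel s m) (Set.Ioi 0) := by
  refine Integrable.mono' ((exp_neg_integrableOn_Ioi 0 hm).const_mul (π * s)⁻¹)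
    (measurable_dampedHeatKernel s m).aestronglyMeasurable ?_
  refine (ae_restrict_iff' measurableSet_Ioi).2 (ae_of_all _ fun t ht => ?_)
  have ht : 0 < t := ht
  rw [norm_of_nonneg (dampedHeatKernel_nonneg s m ht), dampedHeatKernel, sub_eq_add_neg, exp_add,
    ← neg_mul, ← mul_assoc]
  gcongr
  have hy : 0 < s / (4 * t) := by positivity
  have h : exp (-s / (4 * t)) ≤ (s / (4 * t))⁻¹ := by
    rw [neg_div, exp_neg]
    gcongr
    linarith [add_one_le_exp (s / (4 * t))]
  calc (4 * π * t)⁻¹ * exp (-s / (4 * t)) ≤ (4 * π * t)⁻¹ * (s / (4 * t))⁻¹ := by gcongr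
    _ = (π * s)⁻¹ := by field_simp

lemma abs_exp_neg_mul_sub_le (a b : ℝ) {t : ℝ} (ht : 0 < t) :
    |exp (-a * t) - exp (-b * t)| ≤ |a - b| * t * exp (-(min a b) * t) := by
  wlog hab : a ≤ b generalizing a b
  · rw [abs_sub_comm, abs_sub_comm a, min_comm]
    exact this b a (le_of_not_ge hab)
  have h1 : exp (-b * t) = exp (-a * t) * exp (-((b - a) * t)) := by
    rw [← exp_add]; ring_nf
  have h2 := one_sub_le_exp_neg ((b - a) * t)
  have h3 : exp (-b * t) ≤ exp (-a * t) := by gcongr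
  rw [min_eq_left hab, abs_of_nonneg (by linarith), abs_of_nonpos (by linarith), h1]
  nlinarith [exp_pos (-a * t)]

lemma exists_abs_integral_dampedHeatKernel_sub_le {a b : ℝ} (ha : 0 < a) (hb : 0 < b) :
    ∃ C, ∀ s, 0 < s →
      |(∫ t in Set.Ioi (0 : ℝ), dampedHeatKernel s a t) -
        ∫ t in Set.Ioi (0 : ℝ), dampedHeatKernel s b t| ≤ C := by
  refine ⟨∫ t in Set.Ioi (0 : ℝ), (4 * π)⁻¹ * |a - b| * exp (-(min a b) * t), fun s hs => ?_⟩
  rw [← integral_sub (integrableOn_dampedHeatKernel hs ha) (integrableOn_dampedHeatKernel hs hb),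
    ← norm_eq_abs]
  refine norm_integral_le_of_norm_le
    ((exp_neg_integrableOn_Ioi 0 (lt_min ha hb)).const_mul _) ?_
  refine (ae_restrict_iff' measurableSet_Ioi).2 (ae_of_all _ fun t ht => ?_)
  have ht : 0 < t := ht
  have h : dampedHeatKernel s a t - dampedHeatKernel s b t =
      (4 * π * t)⁻¹ * exp (-s / (4 * t)) * (exp (-a * t) - exp (-b * t)) := by
    simp only [dampedHeatKernel, sub_eq_add_neg, exp_add, neg_mul]
    ring
  have h1 : exp (-s / (4 * t)) ≤ 1 :=
    exp_le_one_iff.2 (div_nonpos_of_nonpos_of_nonneg (by linarith) (by positivity))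
  rw [h, norm_mul, norm_of_nonneg (by positivity), norm_eq_abs]
  calc (4 * π * t)⁻¹ * exp (-s / (4 * t)) * |exp (-a * t) - exp (-b * t)|
      ≤ (4 * π * t)⁻¹ * 1 * (|a - b| * t * exp (-(min a b) * t)) := by
        gcongr
        exact abs_exp_neg_mul_sub_le a b ht
    _ = (4 * π)⁻¹ * |a - b| * exp (-(min a b) * t) := by field_simp

lemma neg_log_le_integral_dampedHeatKernel {s : ℝ} (hs : 0 < s) (hs1 : s ≤ 1) :
    (4 * π)⁻¹ * exp (-(5 / 4)) * -log s ≤ ∫ t in Set.Ioi (0 : ℝ), dampedHeatKernel s 1 t := by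
  have hint := integrableOn_dampedHeatKernel hs one_pos
  have hsub : Set.Ioc s 1 ⊆ Set.Ioi 0 := fun t ht => hs.trans ht.1
  calc (4 * π)⁻¹ * exp (-(5 / 4)) * -log s
      = ∫ t in Set.Ioc s 1, (4 * π)⁻¹ * exp (-(5 / 4)) * t⁻¹ := by
        rw [integral_const_mul, ← intervalIntegral.integral_of_le hs1,
          integral_inv_of_pos hs one_pos, one_div, log_inv]
    _ ≤ ∫ t in Set.Ioc s 1, dampedHeatKernel s 1 t := by
        refine setIntegral_mono_on ?_ (hint.mono_set hsub) measurableSet_Ioc fun t ht => ?_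
        · rw [← intervalIntegrable_iff_integrableOn_Ioc_of_le hs1]
          refine (intervalIntegral.intervalIntegrable_inv (fun t ht => ?_)
            continuousOn_id).const_mul _
          rw [Set.uIcc_of_le hs1] at ht
          exact (hs.trans_le ht.1).ne'
        · have ht0 : 0 < t := hs.trans ht.1
          have h : s / (4 * t) ≤ 1 / 4 := by
            rw [div_le_div_iff₀ (by positivity) (by norm_num)]
            linarith [ht.1]
          rw [dampedHeatKernel, mul_inv (4 * π), mul_right_comm]
          gcongr
          rw [neg_div]
          linarith [ht.2]
    _ ≤ ∫ t in Set.Ioi (0 : ℝ), dampedHeatKernel s 1 t :=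
        setIntegral_mono_set hint
          ((ae_restrict_iff' measurableSet_Ioi).2
            (ae_of_all _ fun t ht => dampedHeatKernel_nonneg s 1 ht))
          hsub.eventuallyLE

lemma tendsto_integral_dampedHeatKernel_atTop :
    Tendsto (fun s => ∫ t in Set.Ioi (0 : ℝ), dampedHeatKernel s 1 t) (𝓝[>] 0) atTop := by
  have hlog : Tendsto (fun s => (4 * π)⁻¹ * exp (-(5 / 4)) * -log s) (𝓝[>] 0) atTop :=
    (tendsto_neg_atBot_atTop.comp tendsto_log_nhdsGT_zero).const_mul_atTop (by positivity)
  refine tendsto_atTop_mono' _ ?_ hlog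
  filter_upwards [Ioc_mem_nhdsGT (zero_lt_one' ℝ)] with s hs
  exact neg_log_le_integral_dampedHeatKernel hs.1 hs.2

lemma tendsto_integral_dampedHeatKernel_div {l : ℝ} (hl : 0 < l) :
    Tendsto (fun s => (∫ t in Set.Ioi (0 : ℝ), dampedHeatKernel s l t) /
      ∫ t in Set.Ioi (0 : ℝ), dampedHeatKernel s 1 t) (𝓝[>] 0) (𝓝 1) := by
  obtain ⟨C, hC⟩ := exists_abs_integral_dampedHeatKernel_sub_le hl one_pos
  have htop := tendsto_integral_dampedHeatKernel_atTop
  rw [tendsto_iff_norm_sub_tendsto_zero]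
  refine squeeze_zero' (Eventually.of_forall fun _ => norm_nonneg _) ?_ (htop.const_div_atTop C)
  filter_upwards [htop.eventually_gt_atTop 0, self_mem_nhdsWithin] with s hpos hs
  rw [div_sub_one hpos.ne', norm_div, norm_of_nonneg hpos.le, norm_eq_abs]
  gcongr
  exact hC s hs

/-- Part (ii) of Lemma 3.25: in dimension 2, `G_{2,λ}(x)/G₂(x) → 1` as `x → 0`, `x ≠ 0`. -/
theorem stmt12 (lam : ℝ) (hlam : 0 < lam) :
    Tendsto (fun x : EuclideanSpace ℝ (Fin 2) => besselG 2 (Real.sqrt lam • x) / besselG 2 x)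
      (𝓝[≠] (0 : EuclideanSpace ℝ (Fin 2))) (𝓝 1) := by
  have hnorm : Tendsto (fun x : EuclideanSpace ℝ (Fin 2) => ‖x‖ ^ 2) (𝓝[≠] 0) (𝓝[>] 0) := by
    refine tendsto_nhdsWithin_iff.2 ⟨?_, ?_⟩
    · exact ((by fun_prop : Continuous fun x : EuclideanSpace ℝ (Fin 2) => ‖x‖ ^ 2).tendsto' 0 0
        (by simp)).mono_left nhdsWithin_le_nhds
    · filter_upwards [self_mem_nhdsWithin] with x hx
      exact pow_pos (norm_pos_iff.2 hx) 2
  refine ((tendsto_integral_dampedHeatKernel_div hlam).comp hnorm).congr fun x => ?_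
  rw [Function.comp_apply, besselG_two, besselG_two, norm_smul, mul_pow,
    norm_of_nonneg (sqrt_nonneg lam), sq_sqrt hlam.le, integral_dampedHeatKernel_scale hlam]
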